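/- For every n ≥ 1 and t > 0 (noting R_n(t) > 0), 4 p(n,t) = r_n(t) + r_n(t)² + 2(1 − (−1)^n) t + 4(−1)^n t r_n(t)/R_n(t) − (n + r_n(t)) R_n(t) − n(n−1). -/

import Mathlib

open MeasureTheory Polynomial

/-- The singularly perturbed Gaussian weight `w(x,t) = exp(-x^2 - t/x^2)` for `x ≠ 0`,
extended by `0` at `x = 0`. -/
noncomputable def w (t x : ℝ) : ℝ := if x = 0 then 0 else Real.exp (-x ^ 2 - t / x ^ 2)

/-- `P` is a sequence of monic orthogonal polynomials for the functional `L`, with square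
norms `h`. -/
structure IsMonicOrthogonal (L : ℝ[X] →ₗ[ℝ] ℝ) (P : ℕ → ℝ[X]) (h : ℕ → ℝ) : Prop where
  monic : ∀ n, (P n).Monic
  natDegree : ∀ n, (P n).natDegree = n
  orth : ∀ m n, m ≠ n → L (P m * P n) = 0
  norm : ∀ n, L (P n * P n) = h n
  norm_pos : ∀ n, 0 < h n

namespace IsMonicOrthogonal

variable {L : ℝ[X] →ₗ[ℝ] ℝ} {P : ℕ → ℝ[X]} {h : ℕ → ℝ}

lemma coeff_self (H : IsMonicOrthogonal L P h) (n : ℕ) : (P n).coeff n = 1 := by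
  have := H.monic n
  rwa [Monic, leadingCoeff, H.natDegree] at this

lemma coeff_eq_zero (H : IsMonicOrthogonal L P h) {n k : ℕ} (hk : n < k) :
    (P n).coeff k = 0 :=
  coeff_eq_zero_of_natDegree_lt (by rwa [H.natDegree])

lemma coeff_sub_eq_zero (H : IsMonicOrthogonal L P h) {q : ℝ[X]} {m : ℕ}
    (hq : ∀ k, m < k → q.coeff k = 0) (k : ℕ) (hk : m ≤ k) :
    (q - C (q.coeff m) * P m).coeff k = 0 := by
  rcases hk.eq_or_lt with rfl | hk
  · simp [H.coeff_self]
  · simp [hq k hk, H.coeff_eq_zero hk]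

lemma map_mul_eq_zero_of_le (H : IsMonicOrthogonal L P h) {n m : ℕ} (hm : m ≤ n) :
    ∀ q : ℝ[X], (∀ k, m ≤ k → q.coeff k = 0) → L (q * P n) = 0 := by
  induction m with
  | zero =>
    intro q hq
    have : q = 0 := by ext k; simpa using hq k (Nat.zero_le k)
    simp [this]
  | succ m ih =>
    intro q hq
    have h1 := ih (by omega) _ (H.coeff_sub_eq_zero hq)
    have h2 : L (C (q.coeff m) * P m * P n) = 0 := by
      rw [mul_assoc, ← smul_eq_C_mul, map_smul, H.orth m n (by omega), smul_zero]
    rw [sub_mul, map_sub, h2, sub_zero] at h1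
    exact h1

lemma map_mul_eq_zero (H : IsMonicOrthogonal L P h) {n : ℕ} {q : ℝ[X]}
    (hq : ∀ k, n ≤ k → q.coeff k = 0) : L (q * P n) = 0 :=
  H.map_mul_eq_zero_of_le le_rfl q hq

lemma map_mul_eq (H : IsMonicOrthogonal L P h) {n : ℕ} {q : ℝ[X]}
    (hq : ∀ k, n < k → q.coeff k = 0) : L (q * P n) = q.coeff n * h n := by
  have h1 := H.map_mul_eq_zero (H.coeff_sub_eq_zero hq)
  rw [sub_mul, map_sub, mul_assoc, ← smul_eq_C_mul, map_smul, H.norm, smul_eq_mul] at h1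
  linarith

lemma eq_zero_of_map_mul (H : IsMonicOrthogonal L P h) {m : ℕ} :
    ∀ q : ℝ[X], (∀ k, m ≤ k → q.coeff k = 0) → (∀ j, j < m → L (q * P j) = 0) → q = 0 := by
  induction m with
  | zero =>
    intro q hq _
    ext k
    simpa using hq k (Nat.zero_le k)
  | succ m ih =>
    intro q hq ho
    refine ih q (fun k hk => ?_) (fun j hj => ho j (by omega))
    rcases hk.eq_or_lt with rfl | hk
    · have h1 := H.map_mul_eq (n := m) (q := q) hq
      rw [ho m (by omega)] at h1
      exact (mul_eq_zero.mp h1.symm).resolve_right (H.norm_pos m).ne'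
    · exact hq k hk

lemma comp_neg (H : IsMonicOrthogonal L P h)
    (hL : ∀ q : ℝ[X], L (q.comp (C (-1) * X)) = L q) (n : ℕ) :
    (P n).comp (C (-1) * X) = C ((-1) ^ n) * P n := by
  have hc : ∀ q : ℝ[X], (q.comp (C (-1) * X)).comp (C (-1) * X) = q := by
    intro q
    ext k
    rw [comp_C_mul_X_coeff, comp_C_mul_X_coeff, mul_assoc, ← mul_pow]
    simp
  rw [← sub_eq_zero]
  refine H.eq_zero_of_map_mul (m := n) _ (fun k hk => ?_) (fun j hj => ?_)
  · rw [coeff_sub, comp_C_mul_X_coeff, coeff_C_mul]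
    rcases hk.eq_or_lt with rfl | hk
    · ring
    · rw [H.coeff_eq_zero hk]; ring
  · have h1 : L ((P n).comp (C (-1) * X) * P j) = 0 := by
      rw [← hL, mul_comp, hc, mul_comm]
      refine H.map_mul_eq_zero (fun k hk => ?_)
      rw [comp_C_mul_X_coeff, H.coeff_eq_zero (by omega), zero_mul]
    rw [sub_mul, map_sub, h1, mul_assoc, ← smul_eq_C_mul, map_smul, H.orth n j (by omega)]
    simp

lemma coeff_of_odd (H : IsMonicOrthogonal L P h)
    (hL : ∀ q : ℝ[X], L (q.comp (C (-1) * X)) = L q) {n k : ℕ} (hk : Odd (n + k)) :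
    (P n).coeff k = 0 := by
  have h1 := congrArg (fun q => q.coeff k) (H.comp_neg hL n)
  simp only [comp_C_mul_X_coeff, coeff_C_mul] at h1
  rcases Nat.even_or_odd n with hn | hn
  · have hk' : Odd k := by grind
    rw [hn.neg_one_pow, hk'.neg_one_pow] at h1
    linarith
  · have hk' : Even k := by grind
    rw [hn.neg_one_pow, hk'.neg_one_pow] at h1
    linarith

lemma map_X_mul_self (H : IsMonicOrthogonal L P h)
    (hL : ∀ q : ℝ[X], L (q.comp (C (-1) * X)) = L q) (n : ℕ) :
    L (X * P n * P n) = 0 := by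
  have h1 := hL (X * P n * P n)
  have h2 : (C ((-1 : ℝ) ^ n) * P n) * (C ((-1) ^ n) * P n) = P n * P n := by
    rw [mul_mul_mul_comm, ← C_mul, ← mul_pow]; simp
  rw [mul_assoc, mul_comp, mul_comp, X_comp, H.comp_neg hL, h2, mul_assoc, ← smul_eq_C_mul,
    map_smul, smul_eq_mul] at h1
  rw [mul_assoc]
  linarith

lemma X_mul (H : IsMonicOrthogonal L P h)
    (hL : ∀ q : ℝ[X], L (q.comp (C (-1) * X)) = L q) (n : ℕ) :
    X * P (n + 1) = P (n + 2) + C (h (n + 1) / h n) * P n := by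
  rw [← sub_eq_zero]
  refine H.eq_zero_of_map_mul (m := n + 2) _ (fun k hk => ?_) (fun j hj => ?_)
  · obtain ⟨k, rfl⟩ : ∃ l, k = l + 1 := ⟨k - 1, by omega⟩
    rw [coeff_sub, coeff_add, coeff_X_mul, coeff_C_mul, H.coeff_eq_zero (n := n) (by omega)]
    rcases (show n + 1 ≤ k by omega).eq_or_lt with rfl | hk
    · rw [H.coeff_self, H.coeff_self]; ring
    · rw [H.coeff_eq_zero hk, H.coeff_eq_zero (by omega)]; ring
  · have hXj : ∀ k, j + 1 < k → (X * P j).coeff k = 0 := by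
      intro k hk
      obtain ⟨k, rfl⟩ : ∃ l, k = l + 1 := ⟨k - 1, by omega⟩
      rw [coeff_X_mul, H.coeff_eq_zero (by omega)]
    have hshift : X * P (n + 1) * P j = X * P j * P (n + 1) := by ring
    rw [sub_mul, add_mul, map_sub, map_add, H.orth (n + 2) j (by omega), mul_assoc (C _),
      ← smul_eq_C_mul, map_smul, smul_eq_mul]
    rcases (show j ≤ n + 1 by omega).eq_or_lt with rfl | hj'
    · rw [H.map_X_mul_self hL, H.orth n _ (by omega)]; ring
    rcases (show j ≤ n by omega).eq_or_lt with rfl | hj''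
    · rw [hshift, H.map_mul_eq hXj, coeff_X_mul, H.coeff_self, H.norm]
      have := (H.norm_pos j).ne'
      field_simp
      ring
    · rw [hshift, H.map_mul_eq_zero (fun k hk => hXj k (by omega)), H.orth n j (by omega)]; ring

lemma X_mul_zero (H : IsMonicOrthogonal L P h)
    (hL : ∀ q : ℝ[X], L (q.comp (C (-1) * X)) = L q) : X * P 0 = P 1 := by
  ext k
  rcases k with _ | _ | k
  · rw [coeff_X_mul_zero, H.coeff_of_odd hL (by decide)]
  · rw [coeff_X_mul, H.coeff_self, H.coeff_self]
  · rw [coeff_X_mul, H.coeff_eq_zero (by omega), H.coeff_eq_zero (by omega)]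

lemma map_derivative_mul (H : IsMonicOrthogonal L P h) (n : ℕ) :
    L (derivative (P (n + 1) * P n)) = (n + 1) * h n := by
  have h1 : L (derivative (P (n + 1)) * P n) = (n + 1) * h n := by
    rw [H.map_mul_eq (fun k hk => ?_), coeff_derivative, H.coeff_self, one_mul]
    rw [coeff_derivative, H.coeff_eq_zero (by omega), zero_mul]
  have h2 : L (derivative (P n) * P (n + 1)) = 0 := by
    refine H.map_mul_eq_zero (fun k hk => ?_)
    rw [coeff_derivative, H.coeff_eq_zero (by omega), zero_mul]
  rw [derivative_mul, map_add, h1, mul_comm (P (n + 1)), h2, add_zero]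

end IsMonicOrthogonal

lemma eq_C_add_X_mul_X_mul {q : ℝ[X]} (hq : q.coeff 1 = 0) :
    q = C (q.coeff 0) + X * (X * q.divX.divX) := by
  have h1 := X_mul_divX_add q
  have h2 := X_mul_divX_add q.divX
  rw [coeff_divX, hq, C_0, add_zero] at h2
  rw [h2, add_comm, h1]

lemma map_C_add_X_mul_X_mul_mul (L : ℝ[X] →ₗ[ℝ] ℝ) (c : ℝ) (s g : ℝ[X]) :
    L ((C c + X * (X * s)) * g) = c * L g + L (X * s * (X * g)) := by
  rw [add_mul, map_add, ← smul_eq_C_mul, map_smul, smul_eq_mul]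
  congr 2
  ring

namespace IsMonicOrthogonal

variable {L : ℕ → ℝ[X] →ₗ[ℝ] ℝ} {P : ℕ → ℝ[X]} {h : ℕ → ℝ}

lemma map_mul_map_of_even (H : IsMonicOrthogonal (L 0) P h)
    (hX : ∀ k q, L (k + 1) (X * q) = L k q)
    (hL : ∀ q : ℝ[X], L 0 (q.comp (C (-1) * X)) = L 0 q) {n : ℕ} (hn : Even n) :
    L 2 (P (n + 1) * P (n + 1)) * L 2 (P n * P n) = h n * L 3 (P (n + 1) * P n) := by
  set Q := (P (n + 1)).divX with hQ
  have hPQ : P (n + 1) = X * Q := by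
    have h1 := X_mul_divX_add (P (n + 1))
    rw [H.coeff_of_odd hL (by grind), C_0, add_zero] at h1
    exact h1.symm
  have hQ1 : Q.coeff 1 = 0 := by rw [hQ, coeff_divX, H.coeff_of_odd hL (by grind)]
  have hP1 : (P n).coeff 1 = 0 := H.coeff_of_odd hL (by grind)
  have hQn : Q.coeff n = 1 := by rw [hQ, coeff_divX, H.coeff_self]
  have hQk : ∀ k, n < k → Q.coeff k = 0 := fun k hk => by
    rw [hQ, coeff_divX, H.coeff_eq_zero (by omega)]
  have eQ := eq_C_add_X_mul_X_mul hQ1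
  have eP := eq_C_add_X_mul_X_mul hP1
  have hXs : ∀ q : ℝ[X], (∀ k, n < k → q.coeff k = 0) →
      ∀ k, n + 1 ≤ k → (X * q.divX.divX).coeff k = 0 := by
    intro q hq k hk
    obtain ⟨k, rfl⟩ : ∃ l, k = l + 1 := ⟨k - 1, by omega⟩
    rw [coeff_X_mul, coeff_divX, coeff_divX, hq _ (by omega)]
  have h1 : L 2 (P (n + 1) * P (n + 1)) = Q.coeff 0 * L 0 Q := by
    have e1 : P (n + 1) * P (n + 1) = X * (X * (Q * Q)) := by rw [hPQ]; ring
    have e2 := map_C_add_X_mul_X_mul_mul (L 0) (Q.coeff 0) Q.divX.divX Q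
    rw [← eQ, ← hPQ, H.map_mul_eq_zero (hXs Q hQk), add_zero] at e2
    rw [e1, hX, hX, e2]
  have h2 : h n = (P n).coeff 0 * L 0 Q := by
    have e2 := map_C_add_X_mul_X_mul_mul (L 0) ((P n).coeff 0) (P n).divX.divX Q
    rw [← eP, ← hPQ, H.map_mul_eq_zero (hXs (P n) fun k hk => H.coeff_eq_zero hk), add_zero,
      mul_comm (P n), H.map_mul_eq hQk, hQn, one_mul] at e2
    exact e2
  have h3 : L 3 (P (n + 1) * P n) = L 2 (Q * P n) := by rw [hPQ, mul_assoc, hX]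
  have h4 : Q.coeff 0 * L 2 (P n * P n) = (P n).coeff 0 * L 2 (Q * P n) := by
    have e1 : (Q.coeff 0 • P n - (P n).coeff 0 • Q) * P n =
        X * (X * ((Q.coeff 0 • (P n).divX.divX - (P n).coeff 0 • Q.divX.divX) * P n)) := by
      simp only [smul_eq_C_mul]
      linear_combination (C (Q.coeff 0) * P n) * eP - (C ((P n).coeff 0) * P n) * eQ
    have e2 := congrArg (L 2) e1
    rw [hX, hX, H.map_mul_eq_zero, sub_mul, smul_mul_assoc, smul_mul_assoc, map_sub, map_smul,
      map_smul, smul_eq_mul, smul_eq_mul] at e2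
    · linarith
    · intro k hk
      simp [coeff_divX, hQk (k + 1 + 1) (by omega), H.coeff_eq_zero (show n < k + 1 + 1 by omega)]
  rw [h1, h3]
  linear_combination L 0 Q * h4 - L 2 (Q * P n) * h2

lemma map_mul_map_of_odd (H : IsMonicOrthogonal (L 0) P h)
    (hX : ∀ k q, L (k + 1) (X * q) = L k q)
    (hL : ∀ q : ℝ[X], L 0 (q.comp (C (-1) * X)) = L 0 q) {n : ℕ} (hn : Odd n) :
    L 2 (P (n + 1) * P (n + 1)) * L 2 (P n * P n) = -(h n * L 3 (P (n + 1) * P n)) := by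
  set Q := (P n).divX with hQ
  have hPQ : P n = X * Q := by
    have h1 := X_mul_divX_add (P n)
    rw [H.coeff_of_odd hL (by grind), C_0, add_zero] at h1
    exact h1.symm
  have hQ1 : Q.coeff 1 = 0 := by rw [hQ, coeff_divX, H.coeff_of_odd hL (by grind)]
  have hP1 : (P (n + 1)).coeff 1 = 0 := H.coeff_of_odd hL (by grind)
  have hQk : ∀ k, n ≤ k → Q.coeff k = 0 := fun k hk => by
    rw [hQ, coeff_divX, H.coeff_eq_zero (by omega)]
  have eQ := eq_C_add_X_mul_X_mul hQ1
  have eP := eq_C_add_X_mul_X_mul hP1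
  have hXs : ∀ q : ℝ[X], ∀ k, 1 ≤ k → (X * q.divX.divX).coeff k = q.coeff (k + 1) := by
    intro q k hk
    obtain ⟨k, rfl⟩ : ∃ l, k = l + 1 := ⟨k - 1, by omega⟩
    rw [coeff_X_mul, coeff_divX, coeff_divX]
  have hn1 : 1 ≤ n := hn.pos
  have h1 : L 2 (P n * P n) = Q.coeff 0 * L 0 Q := by
    have e1 : P n * P n = X * (X * (Q * Q)) := by rw [hPQ]; ring
    have e2 := map_C_add_X_mul_X_mul_mul (L 0) (Q.coeff 0) Q.divX.divX Q
    rw [← eQ, ← hPQ, H.map_mul_eq_zero, add_zero] at e2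
    · rw [e1, hX, hX, e2]
    · intro k hk
      rw [hXs Q k (by omega), hQk _ (by omega)]
  have h2 : 0 = (P (n + 1)).coeff 0 * L 0 Q + h n := by
    have e2 := map_C_add_X_mul_X_mul_mul (L 0) ((P (n + 1)).coeff 0) (P (n + 1)).divX.divX Q
    rw [← eP, ← hPQ, mul_comm (P (n + 1)), H.map_mul_eq_zero (fun k hk => hQk k (by omega)),
      H.map_mul_eq, hXs _ n hn1, H.coeff_self, one_mul] at e2
    · exact e2
    · intro k hk
      rw [hXs _ k (by omega), H.coeff_eq_zero (by omega)]
  have h3 : L 3 (P (n + 1) * P n) = L 2 (Q * P (n + 1)) := by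
    rw [mul_comm, hPQ, mul_assoc, hX]
  have h4 : Q.coeff 0 * L 2 (P (n + 1) * P (n + 1)) =
      (P (n + 1)).coeff 0 * L 2 (Q * P (n + 1)) := by
    have e1 : (Q.coeff 0 • P (n + 1) - (P (n + 1)).coeff 0 • Q) * P (n + 1) =
        X * (X * ((Q.coeff 0 • (P (n + 1)).divX.divX - (P (n + 1)).coeff 0 • Q.divX.divX) *
          P (n + 1))) := by
      simp only [smul_eq_C_mul]
      linear_combination (C (Q.coeff 0) * P (n + 1)) * eP -
        (C ((P (n + 1)).coeff 0) * P (n + 1)) * eQ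
    have e2 := congrArg (L 2) e1
    rw [hX, hX, H.map_mul_eq_zero, sub_mul, smul_mul_assoc, smul_mul_assoc, map_sub, map_smul,
      map_smul, smul_eq_mul, smul_eq_mul] at e2
    · linarith
    · intro k hk
      simp [coeff_divX, hQk (k + 1 + 1) (by omega),
        H.coeff_eq_zero (show n + 1 < k + 1 + 1 by omega)]
  rw [h1, h3]
  linear_combination L 0 Q * h4 - L 2 (Q * P (n + 1)) * h2

lemma map_mul_map (H : IsMonicOrthogonal (L 0) P h)
    (hX : ∀ k q, L (k + 1) (X * q) = L k q)
    (hL : ∀ q : ℝ[X], L 0 (q.comp (C (-1) * X)) = L 0 q) (n : ℕ) :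
    L 2 (P (n + 1) * P (n + 1)) * L 2 (P n * P n) =
      (-1) ^ n * (h n * L 3 (P (n + 1) * P n)) := by
  rcases Nat.even_or_odd n with hn | hn
  · rw [H.map_mul_map_of_even hX hL hn, hn.neg_one_pow, one_mul]
  · rw [H.map_mul_map_of_odd hX hL hn, hn.neg_one_pow, neg_one_mul]

end IsMonicOrthogonal

lemma w_of_ne {t x : ℝ} (hx : x ≠ 0) : w t x = Real.exp (-x ^ 2 - t / x ^ 2) := if_neg hx

lemma w_zero (t : ℝ) : w t 0 = 0 := if_pos rfl

lemma w_neg (t x : ℝ) : w t (-x) = w t x := by simp [w]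

lemma w_nonneg (t x : ℝ) : 0 ≤ w t x := by
  unfold w
  split_ifs
  · exact le_rfl
  · positivity

lemma measurable_w (t : ℝ) : Measurable (w t) := by
  unfold w
  exact Measurable.ite (measurableSet_singleton 0) measurable_const (by fun_prop)

lemma w_le {t : ℝ} (ht : 0 < t) (k : ℕ) (x : ℝ) :
    w t x ≤ k.factorial / t ^ k * x ^ (2 * k) * Real.exp (-x ^ 2) := by
  rcases eq_or_ne x 0 with rfl | hx
  · rw [w_zero]
    have : (0 : ℝ) ≤ 0 ^ (2 * k) := by positivity
    positivity
  have hx2 : 0 < x ^ 2 := by positivity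
  have h1 := Real.pow_div_factorial_le_exp (t / x ^ 2) (by positivity) k
  have h2 : Real.exp (-(t / x ^ 2)) ≤ k.factorial / t ^ k * x ^ (2 * k) := by
    rw [Real.exp_neg]
    calc (Real.exp (t / x ^ 2))⁻¹ ≤ ((t / x ^ 2) ^ k / k.factorial)⁻¹ :=
          inv_anti₀ (by positivity) h1
      _ = k.factorial / t ^ k * x ^ (2 * k) := by
          rw [inv_div, div_pow, ← pow_mul]; field_simp
  rw [w_of_ne hx, sub_eq_add_neg, Real.exp_add, mul_comm]
  gcongr

lemma integrable_eval_mul_exp_neg_sq (q : ℝ[X]) :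
    Integrable fun x : ℝ => q.eval x * Real.exp (-x ^ 2) := by
  induction q using Polynomial.induction_on' with
  | add p q hp hq =>
    simp only [eval_add, add_mul]
    exact hp.add hq
  | monomial n a =>
    have h1 := integrable_rpow_mul_exp_neg_mul_sq (b := 1) one_pos (s := n)
      (by have : (0 : ℝ) ≤ n := n.cast_nonneg
          linarith)
    simpa only [eval_monomial, Real.rpow_natCast, neg_mul, one_mul, mul_assoc]
      using h1.const_mul a

lemma integrable_eval_div_pow_mul_w {t : ℝ} (ht : 0 < t) (k : ℕ) (q : ℝ[X]) :
    Integrable fun x : ℝ => q.eval x / x ^ k * w t x := by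
  refine (integrable_eval_mul_exp_neg_sq (C (k.factorial / t ^ k : ℝ) * X ^ k * q)).mono
    (((q.continuous.measurable.div (by fun_prop)).mul
      (measurable_w t)).aestronglyMeasurable) (.of_forall fun x => ?_)
  rcases eq_or_ne x 0 with rfl | hx
  · rw [w_zero, mul_zero, norm_zero]
    exact norm_nonneg _
  simp only [eval_mul, eval_C, eval_pow, eval_X, norm_mul, norm_div, norm_pow,
    Real.norm_of_nonneg (w_nonneg t x), Real.norm_of_nonneg (Real.exp_pos _).le]
  have hx' : 0 < ‖x‖ := norm_pos_iff.mpr hx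
  have hf : ‖(k.factorial : ℝ)‖ = k.factorial := Real.norm_of_nonneg (by positivity)
  have h1 := w_le ht k x
  rw [pow_mul, ← sq_abs, ← pow_mul, ← Real.norm_eq_abs] at h1
  rw [hf, Real.norm_of_nonneg ht.le, ← sq_abs x, ← Real.norm_eq_abs]
  calc ‖q.eval x‖ / ‖x‖ ^ k * w t x
      ≤ ‖q.eval x‖ / ‖x‖ ^ k *
        (k.factorial / t ^ k * ‖x‖ ^ (2 * k) * Real.exp (-‖x‖ ^ 2)) := by gcongr
    _ = _ := by
      rw [two_mul, pow_add]
      field_simp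

lemma hasDerivAt_w {t : ℝ} (ht : 0 < t) (x : ℝ) :
    HasDerivAt (w t) ((2 * t / x ^ 3 - 2 * x) * w t x) x := by
  rcases eq_or_ne x 0 with rfl | hx
  · rw [w_zero, mul_zero, hasDerivAt_iff_isLittleO]
    simp only [w_zero, sub_zero, smul_zero]
    have h1 : w t =O[nhds 0] fun x : ℝ => x ^ 2 := by
      refine Asymptotics.IsBigO.of_bound (1 / t) (.of_forall fun x => ?_)
      have h2 := w_le ht 1 x
      have h3 : Real.exp (-x ^ 2) ≤ 1 := Real.exp_le_one_iff.mpr (by nlinarith [sq_nonneg x])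
      rw [Real.norm_of_nonneg (w_nonneg t x), Real.norm_of_nonneg (sq_nonneg x)]
      calc w t x ≤ _ := h2
        _ ≤ Nat.factorial 1 / t ^ 1 * x ^ (2 * 1) * 1 := by
          have : 0 ≤ x ^ (2 * 1) := by rw [mul_one]; positivity
          gcongr
        _ = 1 / t * x ^ 2 := by simp
    exact h1.trans_isLittleO (Asymptotics.isLittleO_pow_id one_lt_two)
  · have h1 : HasDerivAt (fun x : ℝ => Real.exp (-x ^ 2 - t / x ^ 2))
        (Real.exp (-x ^ 2 - t / x ^ 2) * (-(2 * x) - (0 * x ^ 2 - t * (2 * x)) / (x ^ 2) ^ 2)) x := by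
      have h2 : HasDerivAt (fun x : ℝ => x ^ 2) (2 * x) x := by simpa using hasDerivAt_pow 2 x
      exact (h2.neg.sub ((hasDerivAt_const x t).div h2 (by positivity))).exp
    have h3 : w t =ᶠ[nhds x] fun x : ℝ => Real.exp (-x ^ 2 - t / x ^ 2) := by
      filter_upwards [isOpen_ne.mem_nhds hx] with y hy using w_of_ne hy
    refine (h1.congr_of_eventuallyEq h3).congr_deriv ?_
    rw [w_of_ne hx]
    field_simp
    ring

/-- The functional `q ↦ ∫ q(x) x⁻ᵏ w(x,t) dx` on polynomials. -/
noncomputable def weightFunctional {t : ℝ} (ht : 0 < t) (k : ℕ) : ℝ[X] →ₗ[ℝ] ℝ where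
  toFun q := ∫ x : ℝ, q.eval x / x ^ k * w t x
  map_add' p q := by
    simp only [eval_add, add_div, add_mul]
    exact integral_add (integrable_eval_div_pow_mul_w ht k p) (integrable_eval_div_pow_mul_w ht k q)
  map_smul' a q := by
    simp only [eval_smul, smul_eq_mul, mul_div_assoc, mul_assoc, RingHom.id_apply]
    exact integral_const_mul _ _

lemma weightFunctional_apply {t : ℝ} (ht : 0 < t) (k : ℕ) (q : ℝ[X]) :
    weightFunctional ht k q = ∫ x : ℝ, q.eval x / x ^ k * w t x := rfl

lemma weightFunctional_succ_X_mul {t : ℝ} (ht : 0 < t) (k : ℕ) (q : ℝ[X]) :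
    weightFunctional ht (k + 1) (X * q) = weightFunctional ht k q := by
  rw [weightFunctional_apply, weightFunctional_apply]
  congr 1
  ext x
  rcases eq_or_ne x 0 with rfl | hx
  · simp [w_zero]
  · rw [eval_mul, eval_X, pow_succ', mul_div_mul_left _ _ hx]

lemma weightFunctional_comp_neg {t : ℝ} (ht : 0 < t) (q : ℝ[X]) :
    weightFunctional ht 0 (q.comp (C (-1) * X)) = weightFunctional ht 0 q := by
  rw [weightFunctional_apply, weightFunctional_apply, ← integral_neg_eq_self]
  simp [eval_comp, w_neg]

lemma weightFunctional_derivative {t : ℝ} (ht : 0 < t) (q : ℝ[X]) :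
    weightFunctional ht 0 (derivative q) =
      2 * weightFunctional ht 0 (X * q) - 2 * t * weightFunctional ht 3 q := by
  have i1 := integrable_eval_div_pow_mul_w ht 0 (derivative q)
  have i2 := (integrable_eval_div_pow_mul_w ht 0 (X * q)).const_mul 2
  have i3 := (integrable_eval_div_pow_mul_w ht 3 q).const_mul (2 * t)
  have h1 := integral_eq_zero_of_hasDerivAt_of_integrable
    (f := fun x => q.eval x * w t x)
    (f' := fun x => (derivative q).eval x / x ^ 0 * w t x -
      (2 * ((X * q).eval x / x ^ 0 * w t x) - 2 * t * (q.eval x / x ^ 3 * w t x)))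
    (fun x => ((q.hasDerivAt x).mul (hasDerivAt_w ht x)).congr_deriv (by
      simp only [eval_mul, eval_X, pow_zero]; ring))
    (i1.sub (i2.sub i3)) (by simpa using integrable_eval_div_pow_mul_w ht 0 q)
  have h2 := integral_sub i1 (i2.sub i3)
  have h3 := integral_sub i2 i3
  simp only [Pi.sub_apply] at h2
  rw [h1, h3, integral_const_mul, integral_const_mul] at h2
  simp only [weightFunctional_apply]
  linarith

theorem statement7
    (t : ℝ) (ht : 0 < t)
    (P : ℕ → Polynomial ℝ)
    (hmonic : ∀ n, (P n).Monic)
    (hdeg : ∀ n, (P n).natDegree = n)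
    (horth : ∀ m n : ℕ, m ≠ n → ∫ x : ℝ, (P m).eval x * (P n).eval x * w t x = 0)
    (h : ℕ → ℝ)
    (hh : ∀ n, h n = ∫ x : ℝ, ((P n).eval x) ^ 2 * w t x)
    (hhpos : ∀ n, 0 < h n)
    (R : ℕ → ℝ)
    (hR : ∀ n, R n = 2 * t / h n * ∫ y : ℝ, ((P n).eval y) ^ 2 / y ^ 2 * w t y)
    (r : ℕ → ℝ)
    (hr : ∀ n, 1 ≤ n → r n = 2 * t / h (n - 1) *
      ∫ y : ℝ, (P n).eval y * (P (n - 1)).eval y / y ^ 3 * w t y)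
    (hRpos : ∀ n, 0 < R n)
    (p : ℕ → ℝ)
    (hp0 : p 0 = 0) (hp1 : p 1 = 0)
    (hp : ∀ n, 2 ≤ n → p n = (P n).coeff (n - 2))
    (n : ℕ) (hn : 1 ≤ n) :
    4 * p n = r n + (r n) ^ 2 + 2 * (1 - (-1 : ℝ) ^ n) * t
      + 4 * (-1 : ℝ) ^ n * t * r n / R n - ((n : ℝ) + r n) * R n
      - (n : ℝ) * ((n : ℝ) - 1) := by

  set L := weightFunctional ht with hLdef
  have H : IsMonicOrthogonal (L 0) P h :=
    { monic := hmonic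
      natDegree := hdeg
      orth := fun m n hmn => by simpa [hLdef, weightFunctional_apply] using horth m n hmn
      norm := fun n => by
        rw [hh n]; simp [hLdef, weightFunctional_apply, sq]
      norm_pos := hhpos }
  have hX : ∀ k q, L (k + 1) (X * q) = L k q := weightFunctional_succ_X_mul ht
  have hL : ∀ q, L 0 (q.comp (C (-1) * X)) = L 0 q := weightFunctional_comp_neg ht
  have hne : ∀ n, h n ≠ 0 := fun n => (hhpos n).ne'
  have hR' : ∀ n, R n = 2 * t / h n * L 2 (P n * P n) := fun n => by
    rw [hR n]; simp [hLdef, weightFunctional_apply, sq]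
  have hr' : ∀ n, r (n + 1) = 2 * t / h n * L 3 (P (n + 1) * P n) := fun n => by
    rw [hr (n + 1) (by omega)]; simp [hLdef, weightFunctional_apply]
  have hβ : ∀ n : ℕ, 2 * (h (n + 1) / h n) = n + 1 + r (n + 1) := by
    intro n
    have h1 := weightFunctional_derivative ht (P (n + 1) * P n)
    rw [← hLdef, H.map_derivative_mul, show X * (P (n + 1) * P n) = X * P n * P (n + 1) by ring,
      H.map_mul_eq, coeff_X_mul, H.coeff_self] at h1
    · rw [hr' n]
      have := hne n
      field_simp
      linarith
    · intro k hk
      obtain ⟨k, rfl⟩ : ∃ l, k = l + 1 := ⟨k - 1, by omega⟩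
      rw [coeff_X_mul, H.coeff_eq_zero (by omega)]
  have hRr : ∀ n, R (n + 1) = r (n + 2) + r (n + 1) := by
    intro n
    have h1 : X * (P (n + 1) * P (n + 1)) =
        P (n + 2) * P (n + 1) + (h (n + 1) / h n) • (P (n + 1) * P n) := by
      rw [← mul_assoc, H.X_mul hL, smul_eq_C_mul]; ring
    have h2 := hX 2 (P (n + 1) * P (n + 1))
    rw [h1, map_add, map_smul, smul_eq_mul] at h2
    rw [hR', hr', hr', ← h2]
    have := hne n
    have := hne (n + 1)
    field_simp
  have hR0 : R 0 = r 1 := by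
    rw [hR', hr' 0, ← hX 2 (P 0 * P 0), ← mul_assoc, H.X_mul_zero hL]
  have hRR : ∀ n : ℕ, (n + 1 + r (n + 1)) * R (n + 1) * R n = (-1) ^ n * 4 * t * r (n + 1) := by
    intro n
    have h1 := H.map_mul_map hX hL n
    rw [← hβ, hR', hR' n, hr']
    have := hne n
    have := hne (n + 1)
    field_simp
    linear_combination 4 * h1
  have hpp : ∀ n : ℕ, 4 * p (n + 2) = 4 * p (n + 1) - 2 * (n + 1 + r (n + 1)) := by
    intro n
    have h1 : p (n + 1) = (X * P (n + 1)).coeff n := by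
      rcases n with _ | n
      · rw [coeff_X_mul_zero, hp1]
      · rw [coeff_X_mul, hp _ (by omega)]; rfl
    rw [h1, H.X_mul hL, coeff_add, coeff_C_mul, H.coeff_self, hp _ (by omega), ← hβ]
    simp only [Nat.add_sub_cancel]
    ring
  have key : ∀ n : ℕ, 4 * p (n + 1) = r (n + 1) + r (n + 1) ^ 2 + 2 * (1 + (-1) ^ n) * t
      - (n + 1 + r (n + 1)) * (R n + R (n + 1)) - (n + 1) * n := by
    intro n
    induction n with
    | zero =>
      have h1 := hRR 0
      have h2 : (1 + r 1) * R 1 = 4 * t := by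
        apply mul_right_cancel₀ (hRpos 0).ne'
        rw [hR0] at h1 ⊢
        push_cast at h1
        linear_combination h1
      simp [hp1, hR0]
      linarith
    | succ n ih =>
      have h1 := hRR n
      have h2 := hRR (n + 1)
      have h3 := hRr n
      have h4 : (n + 2 + r (n + 2)) * R (n + 2) - (n + 1 + r (n + 1)) * R n =
          -((-1) ^ n * 4 * t) := by
        apply mul_right_cancel₀ (hRpos (n + 1)).ne'
        push_cast at h2
        linear_combination h2 - h1 + (-1) ^ n * 4 * t * h3
      rw [hpp, ih]
      push_cast
      linear_combination h4 + (r (n + 2) - r (n + 1) + 1) * h3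
  obtain ⟨n, rfl⟩ : ∃ m, n = m + 1 := ⟨n - 1, by omega⟩
  have h1 := hRR n
  have h2 : 4 * (-1) ^ (n + 1) * t * r (n + 1) / R (n + 1) = -((n + 1 + r (n + 1)) * R n) := by
    rw [div_eq_iff (hRpos (n + 1)).ne']
    linear_combination h1
  rw [key, h2]
  push_cast
  ring
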